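/- arXiv:1110.4833 — 2 statements merged into one kernel-verified Lean document; each statement's English description precedes it below -/
import Mathlib

section
/- Let E be a real normed vector space, U ⊆ E an open preconnected set, and a, b : E → Matrix (Fin n) (Fin n) ℝ differentiable maps such that a(x) and b(x) are invertible for every x ∈ U. If the associated pure-gauge connections agree on U, i.e. a(x) * (fderiv ℝ (fun y ↦ (a y)⁻¹) x v) = b(x) * (fderiv ℝ (fun y ↦ (b y)⁻¹) x v) for all x ∈ U and all v ∈ E, then there exists a single invertible matrix h such that b(x) = a(x) * h for all x ∈ U. (Two potentials for the same flat connection differ by a constant transition group element; this is the basis for the well-definedness of the holonomies h_e = a_{s(e)}⁻¹ · a_{t(e)}.) -/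
attribute [local instance] Matrix.normedAddCommGroup Matrix.normedSpace

lemma aux_entry {E : Type*} [NormedAddCommGroup E] [NormedSpace ℝ E] {n : ℕ}
    {f : E → Matrix (Fin n) (Fin n) ℝ} {x : E} :
    DifferentiableAt ℝ f x ↔ ∀ i j, DifferentiableAt ℝ (fun y => f y i j) x := by
  have h1 : DifferentiableAt ℝ f x ↔ ∀ i, DifferentiableAt ℝ (fun y => f y i) x :=
    differentiableAt_pi (F' := fun _ : Fin n => Fin n → ℝ) (Φ := f)
  rw [h1]
  exact forall_congr' fun i => differentiableAt_pi

lemma aux_det {E : Type*} [NormedAddCommGroup E] [NormedSpace ℝ E] {n : ℕ}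
    {f : E → Matrix (Fin n) (Fin n) ℝ} {x : E}
    (h : ∀ i j, DifferentiableAt ℝ (fun y => f y i j) x) :
    DifferentiableAt ℝ (fun y => (f y).det) x := by
  simp only [Matrix.det_apply']
  refine DifferentiableAt.fun_sum fun σ _ => ?_
  refine DifferentiableAt.const_mul ?_ _
  exact (HasFDerivAt.finsetProd (𝕜 := ℝ) (𝔸' := ℝ)
    fun i _ => (h (σ i) i).hasFDerivAt).differentiableAt

lemma aux_inv {E : Type*} [NormedAddCommGroup E] [NormedSpace ℝ E] {n : ℕ}
    {f : E → Matrix (Fin n) (Fin n) ℝ} {x : E}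
    (h : DifferentiableAt ℝ f x) (hu : IsUnit (f x)) :
    DifferentiableAt ℝ (fun y => (f y)⁻¹) x := by
  have h0 := aux_entry.1 h
  rw [aux_entry]
  intro i j
  simp only [Matrix.inv_def, Matrix.smul_apply, smul_eq_mul, Ring.inverse_eq_inv']
  refine DifferentiableAt.mul (DifferentiableAt.inv (aux_det h0) ?_) ?_
  · exact ((Matrix.isUnit_iff_isUnit_det _).1 hu).ne_zero
  · simp only [Matrix.adjugate_apply]
    apply aux_det
    intro k l
    by_cases hk : k = j
    · subst hk
      simp
    · simpa [Matrix.updateRow_ne hk] using h0 k l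

lemma aux_mul {E : Type*} [NormedAddCommGroup E] [NormedSpace ℝ E] {n : ℕ}
    {f g : E → Matrix (Fin n) (Fin n) ℝ} {x : E}
    (hf : DifferentiableAt ℝ f x) (hg : DifferentiableAt ℝ g x) :
    DifferentiableAt ℝ (fun y => f y * g y) x ∧
    ∀ v, fderiv ℝ (fun y => f y * g y) x v = f x * fderiv ℝ g x v + fderiv ℝ f x v * g x := by
  let M := LinearMap.toContinuousBilinearMap (LinearMap.mul ℝ (Matrix (Fin n) (Fin n) ℝ))
  have h := ContinuousLinearMap.hasFDerivAt_of_bilinear (𝕜 := ℝ) (E := Matrix (Fin n) (Fin n) ℝ) (F := Matrix (Fin n) (Fin n) ℝ) (G := Matrix (Fin n) (Fin n) ℝ) (G' := E)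
    M (f := f) (g := g) (x := x) hf.hasFDerivAt hg.hasFDerivAt
  have h' : HasFDerivAt (fun y => f y * g y) _ x := h
  refine ⟨h'.differentiableAt, fun v => ?_⟩
  rw [h'.fderiv]
  rfl

/-- Two potentials for the same flat connection differ by a constant
transition group element: if `a, b` are differentiable, pointwise invertible on an open
preconnected set `U`, and the pure-gauge connections `a · d(a⁻¹)` and `b · d(b⁻¹)` agree on
`U`, then there is a single invertible matrix `h` with `b x = a x * h` for all `x ∈ U`. -/
theorem stmt_11 {E : Type*} [NormedAddCommGroup E] [NormedSpace ℝ E] {n : ℕ}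
    (U : Set E) (hU : IsOpen U) (hUconn : IsPreconnected U)
    (a b : E → Matrix (Fin n) (Fin n) ℝ)
    (hda : Differentiable ℝ a) (hdb : Differentiable ℝ b)
    (hainv : ∀ x ∈ U, IsUnit (a x)) (hbinv : ∀ x ∈ U, IsUnit (b x))
    (hAB : ∀ x ∈ U, ∀ v : E,
      a x * fderiv ℝ (fun y => (a y)⁻¹) x v = b x * fderiv ℝ (fun y => (b y)⁻¹) x v) :
    ∃ h : Matrix (Fin n) (Fin n) ℝ, IsUnit h ∧ ∀ x ∈ U, b x = a x * h := by
  have key : ∀ x ∈ U, DifferentiableAt ℝ (fun y => (a y)⁻¹ * b y) x ∧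
      fderiv ℝ (fun y => (a y)⁻¹ * b y) x = 0 := by
    intro x hx
    have hc := aux_inv (hda x) (hainv x hx)
    have hd := aux_inv (hdb x) (hbinv x hx)
    obtain ⟨h1, h2⟩ := aux_mul hc (hdb x)
    obtain ⟨-, h3⟩ := aux_mul hd (hdb x)
    refine ⟨h1, ?_⟩
    ext1 v
    have hone : (fun y => (b y)⁻¹ * b y) =ᶠ[nhds x] fun _ => 1 := by
      filter_upwards [hU.mem_nhds hx] with y hy
      exact Matrix.nonsing_inv_mul _ ((Matrix.isUnit_iff_isUnit_det _).1 (hbinv y hy))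
    have h4 := h3 v
    rw [hone.fderiv_eq] at h4
    have hz : fderiv ℝ (fun _ : E => (1 : Matrix (Fin n) (Fin n) ℝ)) x v = 0 := by simp
    rw [hz] at h4
    have hab := hAB x hx v
    rw [h2 v]
    generalize fderiv ℝ (fun y => (a y)⁻¹) x v = c' at *
    generalize fderiv ℝ (fun y => (b y)⁻¹) x v = d' at *
    generalize fderiv ℝ b x v = b' at *
    have ha1 := Matrix.nonsing_inv_mul _ ((Matrix.isUnit_iff_isUnit_det _).1 (hainv x hx))
    have hb1 := Matrix.mul_nonsing_inv _ ((Matrix.isUnit_iff_isUnit_det _).1 (hbinv x hx))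
    have e1 : c' = (a x)⁻¹ * (b x * d') := by
      rw [← hab, ← mul_assoc, ha1, one_mul]
    have e2 : b' + b x * d' * b x = 0 := by
      have := congrArg (fun m => b x * m) h4
      simp only [mul_add, ← mul_assoc, hb1, one_mul, mul_zero] at this
      exact this.symm
    change (a x)⁻¹ * b' + c' * b x = 0
    rw [e1, mul_assoc ((a x)⁻¹), ← mul_add, e2, mul_zero]
  obtain ⟨h, hh⟩ := hU.exists_is_const_of_fderiv_eq_zero (𝕜 := ℝ)
    (G := Matrix (Fin n) (Fin n) ℝ) (f := fun y => (a y)⁻¹ * b y) hUconn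
    (fun x hx => (key x hx).1.differentiableWithinAt) (fun x hx => (key x hx).2)
  rcases U.eq_empty_or_nonempty with rfl | ⟨x0, hx0⟩
  · exact ⟨1, isUnit_one, by simp⟩
  · refine ⟨h, ?_, fun x hx => ?_⟩
    · rw [← hh x0 hx0]
      exact (Matrix.isUnit_nonsing_inv_iff.2 (hainv x0 hx0)).mul (hbinv x0 hx0)
    · rw [← hh x hx, ← mul_assoc,
        Matrix.mul_nonsing_inv _ ((Matrix.isUnit_iff_isUnit_det _).1 (hainv x hx)), one_mul]
end

section
/- Let e : ℝ³ → Matrix (Fin 3) (Fin 3) ℝ be a differentiable frame field with e(x) invertible for every x (entries e^i_a, first index internal, second spatial), let γ ≠ 0 be real, and let Γ, K : ℝ³ → Fin 3 → Fin 3 → ℝ be families of components Γ^i_a(x), K^i_a(x). Assume Γ is the Levi-Civita spin connection of e, i.e. for all x, i, a, b: ∂_a e^i_b(x) − ∂_b e^i_a(x) + Σ_{j,k} ε(i,j,k)·(Γ^j_a(x)·e^k_b(x) − Γ^j_b(x)·e^k_a(x)) = 0. Set A^i_a := Γ^i_a + γ·K^i_a. Then the frame field is torsion-free with respect to A, i.e.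 for all x, i, a, b: ∂_a e^i_b(x) − ∂_b e^i_a(x) + Σ_{j,k} ε(i,j,k)·(A^j_a(x)·e^k_b(x) − A^j_b(x)·e^k_a(x)) = 0, if and only if K = 0 identically. (Extrinsic curvature is zero if and only if the frame field is torsion-free.) -/
attribute [local instance] Matrix.normedAddCommGroup Matrix.normedSpace

/-- The Levi-Civita symbol on `Fin 3`: `levicivita i j k` is the sign of the permutation
`(i,j,k)` when the indices are pairwise distinct, and `0` otherwise. -/
def levicivita : Fin 3 → Fin 3 → Fin 3 → ℝ :=
  ![![![0, 0, 0], ![0, 0, 1], ![0, -1, 0]],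
    ![![0, 0, -1], ![0, 0, 0], ![1, 0, 0]],
    ![![0, 1, 0], ![-1, 0, 0], ![0, 0, 0]]]

/-- The `a`-th partial derivative: the Fréchet derivative applied to the `a`-th standard
coordinate direction of `ℝ³`. -/
noncomputable def pd (a : Fin 3) (f : EuclideanSpace ℝ (Fin 3) → ℝ)
    (x : EuclideanSpace ℝ (Fin 3)) : ℝ :=
  fderiv ℝ f x (EuclideanSpace.single a 1)

/-- If `K_a × e_b = K_b × e_a` for all `a, b` and `e` is invertible, then `K = 0`. -/
lemma cross_symm_zero (e K : Matrix (Fin 3) (Fin 3) ℝ) (he : IsUnit e)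
    (h : ∀ i a b : Fin 3, ∑ j : Fin 3, ∑ k : Fin 3,
      levicivita i j k * (K j a * e k b - K j b * e k a) = 0) : K = 0 := by
  obtain ⟨f, hf⟩ := he.exists_left_inv
  set L := K * f with hL
  have hK : K = L * e := by rw [hL, Matrix.mul_assoc, hf, Matrix.mul_one]
  have key : ∀ i, L.transpose * Matrix.of (levicivita i)
      = (Matrix.of (levicivita i)).transpose * L := by
    intro i
    have h1 : K.transpose * Matrix.of (levicivita i) * e
        = e.transpose * (Matrix.of (levicivita i)).transpose * K := by
      ext a b
      have := h i a b
      simp only [Matrix.mul_apply, Matrix.transpose_apply, Matrix.of_apply, Fin.sum_univ_three]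
        at this ⊢
      linear_combination this
    rw [hK, Matrix.transpose_mul] at h1
    have h2 : e.transpose * ((L.transpose * Matrix.of (levicivita i)) * e)
        = e.transpose * (((Matrix.of (levicivita i)).transpose * L) * e) := by
      simpa only [Matrix.mul_assoc] using h1
    have het : IsUnit e.transpose := (Matrix.isUnit_transpose _).2 he
    exact he.mul_right_cancel (het.mul_left_cancel h2)
  have hL0 : L = 0 := by
    have g := fun i a b => congrFun (congrFun (key i) a) b
    simp only [Matrix.mul_apply, Matrix.transpose_apply, Matrix.of_apply,
      Fin.sum_univ_three] at g
    have g01 := fun i => g i 0 1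
    have g02 := fun i => g i 0 2
    have g12 := fun i => g i 1 2
    simp [Fin.forall_fin_succ, levicivita] at g01 g02 g12
    ext i j
    fin_cases i <;> fin_cases j <;> simp <;> grind
  rw [hK, hL0, Matrix.zero_mul]

/-- Let `e : ℝ³ → Matrix (Fin 3) (Fin 3) ℝ` be a differentiable, pointwise
invertible frame field (entries `e x i a`, first index internal, second spatial), `γ ≠ 0`, and
let `Γ` be the Levi-Civita spin connection of `e` (i.e. `e` is torsion-free for `Γ`). Setting
`A = Γ + γ·K`, the frame field is torsion-free with respect to `A` if and only if `K = 0`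
identically. (Extrinsic curvature is zero iff the frame field is torsion-free.) -/
theorem stmt_13 (e : EuclideanSpace ℝ (Fin 3) → Matrix (Fin 3) (Fin 3) ℝ)
    (he : Differentiable ℝ e) (hinv : ∀ x, IsUnit (e x))
    (γ : ℝ) (hγ : γ ≠ 0)
    (Γ K : EuclideanSpace ℝ (Fin 3) → Fin 3 → Fin 3 → ℝ)
    (hΓ : ∀ x (i a b : Fin 3),
      pd a (fun y => e y i b) x - pd b (fun y => e y i a) x
        + ∑ j : Fin 3, ∑ k : Fin 3,
            levicivita i j k * (Γ x j a * e x k b - Γ x j b * e x k a) = 0)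
    (A : EuclideanSpace ℝ (Fin 3) → Fin 3 → Fin 3 → ℝ)
    (hA : ∀ x i a, A x i a = Γ x i a + γ * K x i a) :
    (∀ x (i a b : Fin 3),
      pd a (fun y => e y i b) x - pd b (fun y => e y i a) x
        + ∑ j : Fin 3, ∑ k : Fin 3,
            levicivita i j k * (A x j a * e x k b - A x j b * e x k a) = 0)
    ↔ (∀ x i a, K x i a = 0) := by
  constructor
  · intro h x
    have h0 : Matrix.of (K x) = 0 := by
      refine cross_symm_zero (e x) (Matrix.of (K x)) (hinv x) ?_
      intro i a b
      have h1 := h x i a b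
      have h2 := hΓ x i a b
      apply (mul_eq_zero.1 (?_ : γ * _ = 0)).resolve_left hγ
      simp only [hA, Fin.sum_univ_three, Matrix.of_apply] at h1 h2 ⊢
      linear_combination h1 - h2
    intro i a
    exact congrFun (congrFun h0 i) a
  · intro h x i a b
    simpa only [hA, h, mul_zero, add_zero] using hΓ x i a b
end
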